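/- Let v_1, …, v_d ∈ ℤ² be a sequence of primitive vectors with ε_i = det(v_i, v_{i+1}) ≠ 0 for all i = 1, …, d (indices mod d, so v_{d+1} = v_1 and v_0 = v_d), and let a_i = ε_{i-1}^{-1} ε_i^{-1} det(v_{i+1}, v_{i-1}). For each i let x_i (resp. y_i) be the unique integer with 0 ≤ x_i < |ε_i| such that (v_i, v_{i+1})·[[1, −x_i],[0, |ε_i|]]^{−1} (resp. (v_{i+1}, v_i)·[[1, −y_i],[0, |ε_i|]]^{−1}) is a unimodular integer matrix. For i with |ε_i| ≥ 2 let |ε_i|/x_i = n^{(i)}_1 − 1/(n^{(i)}_2 − 1/(⋯ − 1/n^{(i)}_{l_i})) with all n^{(i)}_j ≥ 2 be the Hirzebruch–Jung continued fraction expansion, and set l_i = 0 when |ε_i| = 1. Then the rotation number of the sequence v_1, …, v_d around the origin equals (1/12) ∑_{i=1}^d [ (3(l_i + 1) − ∑_{j=1}^{l_i} n^{(i)}_j) · ε_i/|ε_i| + a_i − (x_i + y_i)/ε_i ]. -/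

import Mathlib

/-- determinant of the 2×2 matrix with columns `v` and `w` -/
def det2 (v w : Fin 2 → ℤ) : ℤ := v 0 * w 1 - v 1 * w 0

/-- the 2×2 matrix with columns `v` and `w` -/
def colMat (v w : Fin 2 → ℤ) : Matrix (Fin 2) (Fin 2) ℤ := !![v 0, w 0; v 1, w 1]

/-- a 2×2 integer matrix is unimodular if its determinant is `±1` -/
def Unimod (A : Matrix (Fin 2) (Fin 2) ℤ) : Prop := A.det = 1 ∨ A.det = -1

/-- a vector of `ℤ²` is primitive if its components are relatively prime -/
def Primitive (v : Fin 2 → ℤ) : Prop := Int.gcd (v 0) (v 1) = 1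

/-- value of the Hirzebruch–Jung continued fraction `n₁ - 1/(n₂ - 1/(⋯ - 1/n_l))`
(the empty continued fraction has value `0`, and `1/0 = 0` in `ℚ` makes the
singleton case evaluate to `n₁`). -/
def hjEval : List ℤ → ℚ
  | [] => 0
  | n :: ns => (n : ℚ) - 1 / hjEval ns

/-- the signed angle from `v` to `w`, lying in `(-π, π]`; when `det2 v w ≠ 0` it lies in
`(-π, π)` and equals the line integral of `(-y dx + x dy)/(x² + y²)` along the segment
from `v` to `w`. -/
noncomputable def segAngle (v w : Fin 2 → ℤ) : ℝ :=
  Complex.arg (((w 0 : ℂ) + (w 1 : ℂ) * Complex.I) / ((v 0 : ℂ) + (v 1 : ℂ) * Complex.I))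

/-- the rotation number of the cyclic sequence `v 0, …, v (d-1)` around the origin -/
noncomputable def rotationNumber {d : ℕ} [NeZero d] (v : Fin d → Fin 2 → ℤ) : ℝ :=
  (1 / (2 * Real.pi)) * ∑ i : Fin d, segAngle (v i) (v (i + 1))

open Complex in
theorem exp_locInj : IsLocallyInjective Complex.exp := by
  rw [isLocallyInjective_iff_nhds]
  intro x
  refine ⟨_, Metric.ball_mem_nhds x Real.pi_pos, ?_⟩
  intro a ha b hb hab
  rw [exp_eq_exp_iff_exists_int] at hab
  obtain ⟨n, hn⟩ := hab
  have h1 : dist a b < Real.pi + Real.pi :=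
    (dist_triangle_right a b x).trans_lt (add_lt_add ha hb)
  rw [dist_eq_norm, hn, add_sub_cancel_left] at h1
  have h2 : ‖(n : ℂ) * (2 * Real.pi * I)‖ = |(n : ℝ)| * (2 * Real.pi) := by
    simp [abs_of_pos Real.pi_pos]
  rw [h2] at h1
  have h3 : |(n : ℝ)| < 1 := by nlinarith [Real.pi_pos]
  have h4 : |n| < 1 := by exact_mod_cast h3
  have h5 : n = 0 := Int.abs_lt_one_iff.1 h4
  simpa [h5] using hn

open Complex ModularForm in
theorem etaT {z : ℂ} : ModularForm.eta (z+1) = exp (Real.pi * I / 12) * ModularForm.eta z := by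
  have h : ∀ n, eta_q n (z+1) = eta_q n z := by
    intro n
    rw [eta_q_eq_cexp, eta_q_eq_cexp, mul_add, exp_add, mul_one]
    have : exp (2 * Real.pi * I * (n+1)) = 1 := by
      rw [exp_eq_one_iff]; exact ⟨n+1, by push_cast; ring⟩
    rw [this, mul_one]
  simp only [ModularForm.eta, h, Function.Periodic.qParam]
  rw [← mul_assoc, ← exp_add]
  congr 2
  push_cast; ring

open Complex ModularForm in
theorem exists_logEta : ∃ L : ℂ → ℂ, ∀ z : ℂ, 0 < z.im →
    L (z + 1) = L z + Real.pi * I / 12 ∧ L (-1 / z) = L z + (log z - log I) / 2 := by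
  set U : Set ℂ := UpperHalfPlane.upperHalfPlaneSet with hU
  have hUm : ∀ z : ℂ, z ∈ U ↔ 0 < z.im := fun z => Iff.rfl
  have hconv : Convex ℝ U := convex_halfSpace_im_gt 0
  have hIU : I ∈ U := by simp [hUm]
  have hUo : IsOpen U := UpperHalfPlane.isOpen_upperHalfPlaneSet
  have hsc : IsSimplyConnected U := by
    have := hconv.contractibleSpace ⟨I, hIU⟩
    exact (inferInstance : SimplyConnectedSpace U)
  obtain ⟨L, hLc, hL⟩ := exists_continuousOn_eqOn_exp_comp hsc hUo (g := ModularForm.eta)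
    (fun z hz => (differentiableAt_eta_of_mem_upperHalfPlaneSet hz).continuousAt.continuousWithinAt)
    (by rintro ⟨z, hz, h⟩; exact eta_ne_zero hz h)
  have hL' : ∀ z ∈ U, exp (L z) = ModularForm.eta z := hL
  have hinv : ∀ z ∈ U, -1 / z ∈ U := by
    intro z hz
    rw [hUm] at *
    have : 0 < normSq z := normSq_pos.2 (by rintro rfl; simp at hz)
    simp [neg_div]; positivity
  have hne : ∀ z ∈ U, z ≠ 0 := by rintro z hz rfl; simp [hUm] at hz
  have hS : Set.EqOn (fun z => L (-1 / z)) (fun z => L z + (log z - log I) / 2) U := by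
    refine IsSeparatedMap.eqOn_of_comp_eqOn (T2Space.isSeparatedMap exp) exp_locInj hconv.isPreconnected ?_ ?_ ?_ hIU ?_
    · exact hLc.comp (fun z hz => (continuousAt_const.div continuousAt_id (hne z hz)).continuousWithinAt) hinv
    · refine hLc.add (ContinuousOn.div_const (ContinuousOn.sub ?_ continuousOn_const) _)
      intro z hz
      exact (continuousAt_clog (Or.inr (ne_of_gt hz))).continuousWithinAt
    · intro z hz
      have := eta_comp_eq_csqrt_I_inv hz
      simp only [Function.comp, Pi.smul_apply, Pi.mul_apply, smul_eq_mul] at this ⊢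
      rw [hL' _ (hinv z hz), this, exp_add, hL' _ hz, sub_div, exp_sub, sqrt_eq_exp (hne z hz), sqrt_eq_exp I_ne_zero]
      field_simp
    · simp [neg_div]
  have hT : Set.EqOn (fun z => L (z+1)) (fun z => L z + Real.pi * I / 12) U := by
    have hr : exp ((Real.pi / 3 : ℝ) * I) ∈ U := by
      rw [hUm, exp_ofReal_mul_I_im, Real.sin_pi_div_three]; positivity
    set r := exp ((Real.pi / 3 : ℝ) * I) with hrd
    have hr2 : -1 / r = r - 1 := by
      rw [div_eq_iff (hne _ hr)]
      have e1 : r.re = 1 / 2 := by rw [hrd, exp_ofReal_mul_I_re, Real.cos_pi_div_three]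
      have e2 : r.im = √3 / 2 := by rw [hrd, exp_ofReal_mul_I_im, Real.sin_pi_div_three]
      have e3 : √3 * √3 = (3 : ℝ) := Real.mul_self_sqrt (by norm_num)
      apply Complex.ext
      · simp only [mul_re, sub_re, sub_im, neg_re, one_re, one_im, e1, e2]; linarith
      · simp only [mul_im, sub_re, sub_im, neg_im, one_re, one_im, e1, e2]; linarith
    have hmem : r - 1 ∈ U := hr2 ▸ hinv r hr
    refine IsSeparatedMap.eqOn_of_comp_eqOn (T2Space.isSeparatedMap exp) exp_locInj hconv.isPreconnected ?_ ?_ ?_ hmem ?_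
    · exact hLc.comp (by fun_prop) (fun z hz => by simpa [hUm] using hz)
    · exact hLc.add continuousOn_const
    · intro z hz
      have hz1 : z + 1 ∈ U := by simpa [hUm] using hz
      simp only [Function.comp]
      rw [hL' _ hz1, exp_add, hL' _ hz, etaT, mul_comm]
    · have := hS hr
      simp only [hr2] at this
      have hl : log r = (Real.pi / 3 : ℝ) * I := by
        rw [hrd, log_exp] <;> simp <;> linarith [Real.pi_pos]
      simp only [sub_add_cancel, this, hl, log_I]
      push_cast; ring
  exact ⟨L, fun z hz => ⟨hT hz, hS hz⟩⟩

/-- the complex number attached to an integer vector -/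
noncomputable def cx (v : Fin 2 → ℤ) : ℂ := (v 0 : ℂ) + (v 1 : ℂ) * Complex.I

theorem segAngle_eq (v w : Fin 2 → ℤ) : segAngle v w = Complex.arg (cx w / cx v) := rfl

theorem cx_re (v : Fin 2 → ℤ) : (cx v).re = v 0 := by simp [cx]
theorem cx_im (v : Fin 2 → ℤ) : (cx v).im = v 1 := by simp [cx]

theorem cx_ne_left {v w : Fin 2 → ℤ} (h : det2 v w ≠ 0) : cx v ≠ 0 := by
  intro h0
  have h1 := cx_re v
  have h2 := cx_im v
  rw [h0] at h1 h2
  simp only [Complex.zero_re, Complex.zero_im] at h1 h2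
  have h1' : v 0 = 0 := by exact_mod_cast h1.symm
  have h2' : v 1 = 0 := by exact_mod_cast h2.symm
  exact h (by simp [det2, h1', h2'])

theorem cx_ne_right {v w : Fin 2 → ℤ} (h : det2 v w ≠ 0) : cx w ≠ 0 := by
  apply cx_ne_left (w := v)
  intro h'
  apply h
  simp only [det2] at *
  linarith

theorem div_im_eq (v w : Fin 2 → ℤ) :
    (cx w / cx v).im = (det2 v w : ℝ) / Complex.normSq (cx v) := by
  rw [Complex.div_im, cx_re, cx_im, cx_re, cx_im, det2]
  push_cast
  ring

theorem div_im_pos {v w : Fin 2 → ℤ} (h : 0 < det2 v w) : 0 < (cx w / cx v).im := by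
  rw [div_im_eq]
  have : 0 < Complex.normSq (cx v) := Complex.normSq_pos.2 (cx_ne_left h.ne')
  have h' : (0 : ℝ) < det2 v w := by exact_mod_cast h
  positivity

theorem seg_pos {v w : Fin 2 → ℤ} (h : 0 < det2 v w) :
    0 < segAngle v w ∧ segAngle v w < Real.pi := by
  have h1 := div_im_pos h
  rw [segAngle_eq]
  constructor
  · rcases (Complex.arg_nonneg_iff.2 h1.le).lt_or_eq with h2 | h2
    · exact h2
    · have := Complex.arg_eq_zero_iff.1 h2.symm
      linarith [this.2]
  · rcases (Complex.arg_le_pi (cx w / cx v)).lt_or_eq with h2 | h2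
    · exact h2
    · have := Complex.arg_eq_pi_iff.1 h2
      linarith [this.2]

theorem seg_add {u v w : Fin 2 → ℤ} (h1 : 0 < det2 u v) (h2 : 0 < det2 v w)
    (h3 : 0 < det2 u w) : segAngle u w = segAngle u v + segAngle v w := by
  have a1 := seg_pos h1
  have a2 := seg_pos h2
  have a3 := seg_pos h3
  have hu := cx_ne_left h1.ne'
  have hv := cx_ne_left h2.ne'
  have hw := cx_ne_right h2.ne'
  have key : ((segAngle u w : ℝ) : Real.Angle) = ((segAngle u v + segAngle v w : ℝ) : Real.Angle) := by
    rw [segAngle_eq, segAngle_eq, segAngle_eq, Real.Angle.coe_add,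
      ← Complex.arg_mul_coe_angle (div_ne_zero hv hu) (div_ne_zero hw hv)]
    congr 2
    field_simp
  rw [Real.Angle.angle_eq_iff_two_pi_dvd_sub] at key
  obtain ⟨k, hk⟩ := key
  have hp := Real.pi_pos
  have k1 : (k : ℝ) < 1 := by
    by_contra hc
    push Not at hc
    nlinarith
  have k2 : (-1 : ℝ) < k := by
    by_contra hc
    push Not at hc
    nlinarith
  have k1' : k < 1 := by exact_mod_cast k1
  have k2' : -1 < k := by exact_mod_cast k2
  have : k = 0 := by omega
  rw [this] at hk
  simp at hk
  linarith

/-- reflection in the first axis -/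
def refl2 (v : Fin 2 → ℤ) : Fin 2 → ℤ := ![v 0, -v 1]

theorem cx_refl2 (v : Fin 2 → ℤ) : cx (refl2 v) = (starRingEnd ℂ) (cx v) := by
  apply Complex.ext <;> simp [cx_re, cx_im, refl2]

theorem det2_refl2 (v w : Fin 2 → ℤ) : det2 (refl2 v) (refl2 w) = - det2 v w := by
  simp [det2, refl2]; ring

theorem refl2_refl2 (v : Fin 2 → ℤ) : refl2 (refl2 v) = v := by
  ext i; fin_cases i <;> simp [refl2]

theorem refl2_neg (v : Fin 2 → ℤ) : refl2 (-v) = - refl2 v := by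
  ext i; fin_cases i <;> simp [refl2]

theorem refl2_add (v w : Fin 2 → ℤ) : refl2 (v + w) = refl2 v + refl2 w := by
  ext i; fin_cases i <;> simp [refl2]; ring

theorem seg_refl2 {v w : Fin 2 → ℤ} (h : det2 v w ≠ 0) :
    segAngle (refl2 v) (refl2 w) = - segAngle v w := by
  rw [segAngle_eq, segAngle_eq, cx_refl2, cx_refl2, ← map_div₀, Complex.arg_conj, if_neg]
  intro h0
  have h1 := (Complex.arg_eq_pi_iff.1 h0).2
  rw [div_im_eq] at h1
  have h2 := Complex.normSq_pos.2 (cx_ne_left h)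
  have h3 : (det2 v w : ℝ) ≠ 0 := by exact_mod_cast h
  exact (div_ne_zero h3 h2.ne') h1

theorem seg_swap {v w : Fin 2 → ℤ} (h : det2 v w ≠ 0) :
    segAngle w v = - segAngle v w := by
  rw [segAngle_eq, segAngle_eq, ← inv_div, Complex.arg_inv, if_neg]
  intro h0
  have h1 := (Complex.arg_eq_pi_iff.1 h0).2
  rw [div_im_eq] at h1
  have h2 := Complex.normSq_pos.2 (cx_ne_left h)
  have h3 : (det2 v w : ℝ) ≠ 0 := by exact_mod_cast h
  exact (div_ne_zero h3 h2.ne') h1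

def FrameFn (G : (Fin 2 → ℤ) → (Fin 2 → ℤ) → ℝ) : Prop :=
  ∀ v w, det2 v w = 1 → G v (w + v) = G v w + 1 / 12 ∧
    G w (-v) = G v w + segAngle v w / (2 * Real.pi) - 1 / 4

theorem exists_frameFn : ∃ G, FrameFn G := by
  obtain ⟨L, hL⟩ := exists_logEta
  refine ⟨fun v w => (L (cx w / cx v)).im / Real.pi, ?_⟩
  intro v w h
  have hp := Real.pi_ne_zero
  have hv := cx_ne_left (v := v) (w := w) (by omega)
  have hw := cx_ne_right (v := v) (w := w) (by omega)
  obtain ⟨h1, h2⟩ := hL (cx w / cx v) (div_im_pos (by omega))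
  have e1 : cx (w + v) / cx v = cx w / cx v + 1 := by
    rw [← div_self hv, ← add_div]
    congr 1
    apply Complex.ext <;> simp [cx_re, cx_im]
  have e2 : cx (-v) / cx w = -1 / (cx w / cx v) := by
    have : cx (-v) = - cx v := by apply Complex.ext <;> simp [cx_re, cx_im]
    rw [this]
    field_simp
  constructor
  · simp only [e1, h1]
    have : (Real.pi * Complex.I / 12 : ℂ).im = Real.pi / 12 := by simp
    rw [Complex.add_im, this]
    field_simp
  · simp only [e2, h2, segAngle_eq]
    have : ((Complex.log (cx w / cx v) - Complex.log Complex.I) / 2 : ℂ).im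
        = ((cx w / cx v).arg - Real.pi / 2) / 2 := by
      simp [Complex.log_im]
    rw [Complex.add_im, this]
    field_simp
    ring

theorem FrameFn.refl {G} (hG : FrameFn G) : FrameFn (fun v w => - G (refl2 v) (- refl2 w)) := by
  intro v w h
  have hd : det2 (refl2 v) (refl2 w) = -1 := by rw [det2_refl2, h]
  constructor
  · have := (hG (refl2 v) (- refl2 w - refl2 v) (by simp only [det2, Pi.sub_apply, Pi.neg_apply] at *; linarith)).1
    rw [sub_add_cancel] at this
    have e : - refl2 (w + v) = - refl2 w - refl2 v := by rw [refl2_add]; abel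
    simp only [e]
    linarith
  · have := (hG (refl2 w) (refl2 v) (by simp only [det2] at *; linarith)).2
    simp only [refl2_neg, neg_neg]
    rw [seg_swap (v := refl2 v) (w := refl2 w) (by omega), seg_refl2 (by omega)] at this
    rw [this]; ring

theorem FrameFn.shift {G} (hG : FrameFn G) {v w : Fin 2 → ℤ} (h : det2 v w = 1) (k : ℤ) :
    G v (w + k • v) = G v w + k / 12 := by
  have hd : ∀ k : ℤ, det2 v (w + k • v) = 1 := by
    intro k
    simp only [det2, Pi.add_apply, Pi.smul_apply, smul_eq_mul] at *
    linarith
  induction k using Int.induction_on with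
  | zero => simp
  | succ i ih =>
    have := (hG v _ (hd i)).1
    rw [add_smul, one_smul, ← add_assoc, this, ih]
    push_cast; ring
  | pred i ih =>
    have := (hG v _ (hd (-i - 1))).1
    have e : w + (-(i : ℤ) - 1) • v + v = w + (-(i : ℤ)) • v := by
      rw [sub_smul, one_smul]; abel
    rw [e, ih] at this
    push_cast at *
    linarith

theorem hjEval_nonneg : ∀ ns : List ℤ, (∀ m ∈ ns, 2 ≤ m) → ns = [] ∨ 1 < hjEval ns := by
  intro ns
  induction ns with
  | nil => intro _; left; rfl
  | cons n ns ih =>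
    intro h
    right
    have hn : (2 : ℚ) ≤ n := by exact_mod_cast h n (by simp)
    rw [hjEval]
    rcases ih (fun m hm => h m (by simp [hm])) with h1 | h1
    · subst h1; simp [hjEval]; linarith
    · have : 1 / hjEval ns < 1 := by rw [div_lt_one (by linarith)]; exact h1
      linarith

theorem chain {G} (hG : FrameFn G) : ∀ (ns : List ℤ), (∀ m ∈ ns, 2 ≤ m) →
    ∀ (v w v' w' : Fin 2 → ℤ) (m x : ℤ), det2 v w = 1 → det2 v' w' = 1 →
    v' = m • w - x • v → 0 ≤ x → x < m → hjEval ns = (m : ℚ) / x →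
    0 ≤ det2 w' v → det2 w' v < m →
    segAngle v v' / (2 * Real.pi) =
      (3 * ((ns.length : ℝ) + 1) - (ns.sum : ℝ)) / 12 + G v' w' - G v w := by
  intro ns
  induction ns with
  | nil =>
    intro _ v w v' w' m x hd hd' hv' hx hxm hj hy hym
    have hx0 : x = 0 := by
      by_contra hx0
      have : (x : ℚ) ≠ 0 := by exact_mod_cast hx0
      have hm : (m : ℚ) ≠ 0 := by exact_mod_cast (by omega : m ≠ 0)
      exact (div_ne_zero hm this) (by rw [← hj]; rfl)
    subst hx0
    have hm1 : m = 1 := by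
      have : m * det2 w w' = 1 := by
        rw [← hd', hv']; simp [det2]; ring
      exact Int.eq_one_of_mul_eq_one_right (by omega) this
    subst hm1
    have hvw : v' = w := by rw [hv']; simp
    subst hvw
    have hy0 : det2 w' v = 0 := by omega
    have hw' : w' = -v := by
      simp only [det2] at hd hd' hy0
      ext i; fin_cases i
      · simp only [Fin.zero_eta, Pi.neg_apply]
        linear_combination (-w' 0) * hd - v 0 * hd' - v' 0 * hy0
      · simp only [Fin.mk_one, Pi.neg_apply]
        linear_combination (-w' 1) * hd - v 1 * hd' - v' 1 * hy0
    subst hw'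
    have := (hG v v' hd).2
    rw [this]
    simp; ring
  | cons n ns ih =>
    intro hns v w v' w' m x hd hd' hv' hx hxm hj hy hym
    have hm0 : (0 : ℚ) < m := by exact_mod_cast (by omega : 0 < m)
    have h1 : 1 < hjEval (n :: ns) := by
      rcases hjEval_nonneg _ hns with h | h
      · simp at h
      · exact h
    have hx0 : 0 < x := by
      rcases hx.lt_or_eq with h | h
      · exact h
      · rw [hj, ← h] at h1; norm_num at h1
    have hxq : (0 : ℚ) < x := by exact_mod_cast hx0
    have hinv : 1 / hjEval ns = ((n * x - m : ℤ) : ℚ) / x := by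
      rw [hjEval] at hj
      push_cast
      rw [sub_div, mul_div_assoc, div_self hxq.ne', ← hj]; ring
    have hj2 : hjEval ns = (x : ℚ) / ((n * x - m : ℤ) : ℚ) := by
      rw [← inv_div, ← hinv, one_div, inv_inv]
    have hb : 0 ≤ n * x - m ∧ n * x - m < x := by
      have hb' : 0 ≤ 1 / hjEval ns ∧ 1 / hjEval ns < 1 := by
        rcases hjEval_nonneg ns (fun m hm => hns m (by simp [hm])) with h | h
        · subst h; simp [hjEval]
        · exact ⟨by positivity, by rw [div_lt_one (by linarith)]; exact h⟩
      rw [hinv] at hb'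
      constructor
      · have := mul_nonneg hb'.1 hxq.le
        rw [div_mul_cancel₀ _ hxq.ne'] at this
        exact_mod_cast this
      · have := (div_lt_one hxq).1 hb'.2
        exact_mod_cast this
    have hd1 : det2 w (-v + n • w) = 1 := by
      simp only [det2, Pi.add_apply, Pi.smul_apply, smul_eq_mul, Pi.neg_apply] at *
      linarith
    have hd0 : det2 w (-v) = 1 := by
      simp only [det2, Pi.neg_apply] at *
      linarith
    have hv1 : v' = x • (-v + n • w) - (n * x - m) • w := by
      rw [hv']; ext i; simp; ring
    have rel : m * det2 w' w = x * det2 w' v - 1 := by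
      rw [hv'] at hd'
      simp only [det2, Pi.sub_apply, Pi.smul_apply, smul_eq_mul] at *
      linarith
    have hy1 : 0 ≤ det2 w' w := by
      have h2 : 0 ≤ x * det2 w' v := by positivity
      by_contra hc
      push Not at hc
      nlinarith
    have hy2 : det2 w' w < x := by
      by_contra hc
      push Not at hc
      nlinarith
    have := ih (fun m hm => hns m (by simp [hm])) w (-v + n • w) v' w' x (n * x - m) hd1 hd' hv1
      hb.1 hb.2 hj2 hy1 hy2
    rw [hG.shift hd0, (hG v w hd).2] at this
    have e1 : det2 w v' = x := by
      rw [hv']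
      simp only [det2, Pi.sub_apply, Pi.smul_apply, smul_eq_mul] at *
      linear_combination x * hd
    have e2 : det2 v v' = m := by
      rw [hv']
      simp only [det2, Pi.sub_apply, Pi.smul_apply, smul_eq_mul] at *
      linear_combination m * hd
    rw [seg_add (u := v) (v := w) (w := v') (by omega) (by omega) (by omega), add_div, this]
    simp only [List.length_cons, List.sum_cons]
    push_cast
    ring

theorem unimod_data {v v' : Fin 2 → ℤ} {m x : ℤ} {P : Matrix (Fin 2) (Fin 2) ℤ}
    (h : P * !![1, -x; 0, m] = colMat v v') :
    ∃ p : Fin 2 → ℤ, v' = m • p - x • v ∧ det2 v v' = m * det2 v p := by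
  have h00 := congrFun (congrFun h 0) 0
  have h01 := congrFun (congrFun h 0) 1
  have h10 := congrFun (congrFun h 1) 0
  have h11 := congrFun (congrFun h 1) 1
  simp [Matrix.mul_apply, Fin.sum_univ_two, colMat] at h00 h01 h10 h11
  refine ⟨![P 0 1, P 1 1], ?_, ?_⟩
  · ext i; fin_cases i
    · simp; rw [← h01, ← h00]; ring
    · simp; rw [← h11, ← h10]; ring
  · simp [det2]; rw [← h01, ← h00, ← h11, ← h10]; ring

/-- two frames with the same first vector differ by a shift -/
theorem frame_shift {v w p : Fin 2 → ℤ} (h : det2 v w = 1) (hp : det2 v p = 1) :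
    p = w + (det2 p w) • v := by
  simp only [det2] at *
  ext i; fin_cases i
  · simp
    linear_combination (-p 0) * h + w 0 * hp
  · simp
    linear_combination (-p 1) * h + w 1 * hp

theorem pair_pos {G} (hG : FrameFn G) {v v' w w' : Fin 2 → ℤ} {e x y : ℤ} {ns : List ℤ}
    (he : 0 < e) (hd : det2 v v' = e) (hw : det2 v w = 1) (hw' : det2 v' w' = 1)
    (hx0 : 0 ≤ x) (hxe : x < e) (hy0 : 0 ≤ y) (hye : y < e)
    {p q : Fin 2 → ℤ} (hp : v' = e • p - x • v) (hp1 : det2 v p = 1)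
    (hq : v = e • q - y • v') (hq1 : det2 v' q = -1)
    (hns : ∀ m ∈ ns, 2 ≤ m) (hj : hjEval ns = (e : ℚ) / x) :
    segAngle v v' / (2 * Real.pi) = (3 * ((ns.length : ℝ) + 1) - (ns.sum : ℝ)) / 12
      - ((x : ℝ) + y) / e / 12 - ((det2 v' w : ℝ) + det2 v w') / e / 12 + G v' w' - G v w := by
  have hq1' : det2 v' (-q) = 1 := by simp only [det2, Pi.neg_apply] at *; linarith
  have hyd : det2 (-q) v = y := by
    rw [hq]
    simp only [det2, Pi.neg_apply, Pi.sub_apply, Pi.smul_apply, smul_eq_mul] at *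
    linear_combination (-y) * hq1
  have key := chain hG ns hns v p v' (-q) e x hp1 hq1' hp hx0 hxe hj (by omega) (by omega)
  have s1 := hG.shift hw (det2 p w)
  rw [← frame_shift hw hp1] at s1
  have s2 := hG.shift hw' (det2 (-q) w')
  rw [← frame_shift hw' hq1'] at s2
  have k1 : e * det2 p w = x + det2 v' w := by
    rw [hp]
    simp only [det2, Pi.neg_apply, Pi.sub_apply, Pi.smul_apply, smul_eq_mul] at *
    linear_combination x * hw
  have k2 : e * det2 (-q) w' = -(y + det2 v w') := by
    have : det2 v w' = e * det2 q w' - y * det2 v' w' := by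
      conv_lhs => rw [hq]
      simp only [det2, Pi.neg_apply, Pi.sub_apply, Pi.smul_apply, smul_eq_mul]
      ring
    rw [this, hw']
    simp only [det2, Pi.neg_apply]
    ring
  have k1' : (e : ℝ) * det2 p w = x + det2 v' w := by exact_mod_cast k1
  have k2' : (e : ℝ) * det2 (-q) w' = -(y + det2 v w') := by exact_mod_cast k2
  have he' : (e : ℝ) ≠ 0 := by exact_mod_cast he.ne'
  have k1'' : (det2 p w : ℝ) = (x + det2 v' w) / e := by rw [← k1']; field_simp
  have k2'' : (det2 (-q) w' : ℝ) = -(y + det2 v w') / e := by rw [← k2']; field_simp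
  rw [key, s1, s2, k1'', k2'']
  ring

theorem refl2_comb (m x : ℤ) (p v : Fin 2 → ℤ) :
    refl2 (m • p - x • v) = m • refl2 p - x • refl2 v := by
  ext i; fin_cases i <;> simp [refl2]; ring

theorem pair_gen {G} (hG : FrameFn G) {v v' w w' : Fin 2 → ℤ} {e x y : ℤ} {ns : List ℤ}
    (he : e ≠ 0) (hd : e = det2 v v') (hw : det2 v w = 1) (hw' : det2 v' w' = 1)
    (hx : 0 ≤ x ∧ x < |e| ∧ ∃ P, Unimod P ∧ P * !![1, -x; 0, |e|] = colMat v v')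
    (hy : 0 ≤ y ∧ y < |e| ∧ ∃ Q, Unimod Q ∧ Q * !![1, -y; 0, |e|] = colMat v' v)
    (hn1 : |e| = 1 → ns = [])
    (hn2 : 2 ≤ |e| → (∀ m ∈ ns, 2 ≤ m) ∧ hjEval ns = (|e| : ℚ) / (x : ℚ)) :
    segAngle v v' / (2 * Real.pi) =
      (3 * ((ns.length : ℝ) + 1) - (ns.sum : ℝ)) * ((e : ℝ) / ((|e| : ℤ) : ℝ)) / 12
      - ((x : ℝ) + y) / e / 12 - ((det2 v' w : ℝ) + det2 v w') / e / 12 + G v' w' - G v w := by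
  obtain ⟨hx0, hxe, P, -, hP⟩ := hx
  obtain ⟨hy0, hye, Q, -, hQ⟩ := hy
  obtain ⟨p, hp, hp1⟩ := unimod_data hP
  obtain ⟨q, hq, hq1⟩ := unimod_data hQ
  have hpos : 0 < |e| := abs_pos.2 he
  have hnn : (∀ m ∈ ns, 2 ≤ m) ∧ hjEval ns = ((|e| : ℤ) : ℚ) / (x : ℚ) := by
    rcases (show |e| = 1 ∨ 2 ≤ |e| by omega) with h | h
    · have hx0 : x = 0 := by omega
      rw [hn1 h, hx0]
      simp [hjEval]
    · have := hn2 h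
      refine ⟨this.1, ?_⟩
      rw [this.2]; push_cast; rfl
  have hsw : det2 v' v = - e := by rw [hd]; simp only [det2]; ring
  rcases lt_or_gt_of_ne he with hneg | hgt
  · have habs : |e| = -e := abs_of_neg hneg
    rw [habs] at hxe hye hp hp1 hq hq1 hpos hnn ⊢
    have hp2 : det2 v p = -1 := by
      rw [← hd] at hp1
      apply mul_left_cancel₀ (a := -e) (by omega)
      linarith
    have hq2 : det2 v' q = 1 := by
      rw [hsw] at hq1
      apply mul_left_cancel₀ (a := -e) (by omega)
      linarith
    have hne : det2 v v' ≠ 0 := by omega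
    have key := pair_pos (hG.refl) (v := refl2 v) (v' := refl2 v') (w := refl2 (-w))
      (w' := refl2 (-w')) (e := -e) (x := x) (y := y) (ns := ns) (p := refl2 p) (q := refl2 q)
      hpos (by rw [det2_refl2, ← hd])
      (by rw [det2_refl2]; simp only [det2, Pi.neg_apply] at *; linarith)
      (by rw [det2_refl2]; simp only [det2, Pi.neg_apply] at *; linarith)
      hx0 hxe hy0 hye (by rw [← refl2_comb, ← hp]) (by rw [det2_refl2, hp2]; rfl)
      (by rw [← refl2_comb, ← hq]) (by rw [det2_refl2, hq2]) hnn.1 hnn.2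
    rw [seg_refl2 hne, det2_refl2, det2_refl2] at key
    simp only [refl2_refl2, neg_neg] at key
    have d1 : det2 v' (-w) = - det2 v' w := by simp only [det2, Pi.neg_apply]; ring
    have d2 : det2 v (-w') = - det2 v w' := by simp only [det2, Pi.neg_apply]; ring
    rw [d1, d2] at key
    have he' : (e : ℝ) ≠ 0 := by exact_mod_cast he
    push_cast at key ⊢
    rw [div_neg, div_self he']
    rw [div_neg, div_neg] at key
    simp only [neg_add_rev, neg_neg, neg_div, add_div, sub_neg_eq_add] at key ⊢
    linarith
  · have habs : |e| = e := abs_of_pos hgt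
    rw [habs] at hxe hye hp hp1 hq hq1 hpos hnn ⊢
    have hp2 : det2 v p = 1 := by
      rw [← hd] at hp1
      apply mul_left_cancel₀ (a := e) (by omega)
      linarith
    have hq2 : det2 v' q = -1 := by
      rw [hsw] at hq1
      apply mul_left_cancel₀ (a := e) (by omega)
      linarith
    have he' : (e : ℝ) ≠ 0 := by exact_mod_cast he
    rw [div_self he', mul_one]
    exact pair_pos hG hgt hd.symm hw hw' hx0 hxe hy0 hye hp hp2 hq hq2 hnn.1 hnn.2

theorem exists_frame {v : Fin 2 → ℤ} (h : Primitive v) : ∃ w, det2 v w = 1 := by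
  refine ⟨![-Int.gcdB (v 0) (v 1), Int.gcdA (v 0) (v 1)], ?_⟩
  have := Int.gcd_eq_gcd_ab (v 0) (v 1)
  rw [h] at this
  simp only [det2, Matrix.cons_val_zero, Matrix.cons_val_one]
  push_cast at this
  linarith

/-- Main theorem: the rotation number of a sequence of primitive vectors with all
`εᵢ ≠ 0` is `(1/12) ∑ᵢ ((3(lᵢ+1) - ∑ⱼ nⱼ⁽ⁱ⁾) εᵢ/|εᵢ| + aᵢ - (xᵢ+yᵢ)/εᵢ)`. -/
theorem rotation_number_of_primitive_vector_sequence
    (d : ℕ) [NeZero d] (v : Fin d → Fin 2 → ℤ)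
    (hprim : ∀ i, Primitive (v i))
    (ε : Fin d → ℤ) (hε : ∀ i, ε i = det2 (v i) (v (i + 1)))
    (hε0 : ∀ i, ε i ≠ 0)
    (a : Fin d → ℚ)
    (ha : ∀ i, a i = (ε (i - 1) : ℚ)⁻¹ * (ε i : ℚ)⁻¹ * (det2 (v (i + 1)) (v (i - 1)) : ℚ))
    -- `x i` is the integer of Lemma 2.1 for the pair `(v i, v (i+1))`
    (x : Fin d → ℤ)
    (hx : ∀ i, 0 ≤ x i ∧ x i < |ε i| ∧
      ∃ P, Unimod P ∧ P * !![1, -(x i); 0, |ε i|] = colMat (v i) (v (i + 1)))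
    -- `y i` is the integer of Lemma 2.1 for the pair `(v (i+1), v i)`
    (y : Fin d → ℤ)
    (hy : ∀ i, 0 ≤ y i ∧ y i < |ε i| ∧
      ∃ Q, Unimod Q ∧ Q * !![1, -(y i); 0, |ε i|] = colMat (v (i + 1)) (v i))
    -- `n i` is the list of partial quotients of the Hirzebruch–Jung continued fraction
    -- expansion of `|ε i| / x i` (the empty list when `|ε i| = 1`); `l i = (n i).length`
    (n : Fin d → List ℤ)
    (hn1 : ∀ i, |ε i| = 1 → n i = [])
    (hn2 : ∀ i, 2 ≤ |ε i| →
      (∀ m ∈ n i, 2 ≤ m) ∧ hjEval (n i) = (|ε i| : ℚ) / (x i : ℚ)) :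
    rotationNumber v = (1 / 12) * ∑ i : Fin d,
      ((3 * (((n i).length : ℝ) + 1) - ((n i).sum : ℝ)) * ((ε i : ℝ) / ((|ε i| : ℤ) : ℝ))
        + (a i : ℝ) - ((x i : ℝ) + (y i : ℝ)) / (ε i : ℝ)) := by
  obtain ⟨G, hG⟩ := exists_frameFn
  choose w hw using fun i => exists_frame (hprim i)
  have key := fun i => pair_gen hG (hε0 i) (hε i) (hw i) (hw (i + 1)) (hx i) (hy i)
    (hn1 i) (hn2 i)
  have ha' : ∀ i, (a i : ℝ) = -((det2 (v (i + 1)) (w i) : ℝ) / ε i)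
      - (det2 (v (i - 1)) (w i) : ℝ) / ε (i - 1) := by
    intro i
    have h1 : (ε i : ℝ) ≠ 0 := by exact_mod_cast hε0 i
    have h2 : (ε (i - 1) : ℝ) ≠ 0 := by exact_mod_cast hε0 (i - 1)
    have hz : det2 (v (i + 1)) (v (i - 1)) =
        - det2 (v (i + 1)) (w i) * ε (i - 1) - det2 (v (i - 1)) (w i) * ε i := by
      have e1 := hε (i - 1)
      rw [sub_add_cancel] at e1
      rw [e1, hε i]
      have := hw i
      simp only [det2] at *
      linear_combination (-(v (i + 1) 0 * v (i - 1) 1 - v (i + 1) 1 * v (i - 1) 0)) * this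
    have hz' : (det2 (v (i + 1)) (v (i - 1)) : ℝ) =
        - det2 (v (i + 1)) (w i) * ε (i - 1) - det2 (v (i - 1)) (w i) * ε i := by
      exact_mod_cast hz
    rw [ha i]
    push_cast
    rw [hz']
    field_simp
  have r1 : ∑ i, (det2 (v (i - 1)) (w i) : ℝ) / ε (i - 1)
      = ∑ i, (det2 (v i) (w (i + 1)) : ℝ) / ε i := by
    rw [← Equiv.sum_comp (Equiv.addRight (1 : Fin d))]
    simp
  have r2 : ∑ i, G (v (i + 1)) (w (i + 1)) = ∑ i, G (v i) (w i) :=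
    Equiv.sum_comp (Equiv.addRight (1 : Fin d)) (fun i => G (v i) (w i))
  have hL : rotationNumber v = ∑ i, segAngle (v i) (v (i + 1)) / (2 * Real.pi) := by
    rw [rotationNumber, ← Finset.sum_div]; ring
  have hA : ∑ i, (a i : ℝ) = -∑ i, ((det2 (v (i + 1)) (w i) : ℝ) + det2 (v i) (w (i + 1))) / ε i := by
    simp only [ha', Finset.sum_sub_distrib, Finset.sum_neg_distrib, r1, add_div,
      Finset.sum_add_distrib]
    ring
  rw [hL, Finset.sum_congr rfl (fun i _ => key i)]
  simp only [Finset.sum_sub_distrib, Finset.sum_add_distrib, ← Finset.sum_div, r2, hA]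
  ring
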